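/- Let N > 0 and C ≥ 0, and let (ρ_k) be a sequence of nonnegative functions in L¹(ℝ³) with ∫ρ_k = N for all k and sup_k sup_{x∈ℝ³} ∫_{ℝ³} ρ_k(y)/|x−y|² dy ≤ C². If (ρ_k) is vanishing, i.e. for every R > 0 one has lim_{k→∞} sup_{y∈ℝ³} ∫_{B(y,R)} ρ_k = 0, then lim_{k→∞} D(ρ_k) = 0. -/

import Mathlib

open MeasureTheory Metric Filter
open scoped ENNReal

/-- The Coulomb energy `D(ρ) = (1/2)∫∫ ρ(x)ρ(y)/|x-y| dx dy`, with value in `[0,∞]`. -/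
noncomputable def coulombEnergy (ρ : EuclideanSpace ℝ (Fin 3) → ℝ) : ℝ≥0∞ :=
  (1/2) * ∫⁻ x, ∫⁻ y, ENNReal.ofReal (ρ x * ρ y / ‖x - y‖)

/-- For `r < 1/δ` the first two terms dominate by AM-GM, otherwise the last one does. -/
lemma inv_le_mul_inv_sq_add_indicator {δ r : ℝ} (hδ : 0 < δ) (hr : 0 ≤ r) :
    r⁻¹ ≤ δ * (r ^ 2)⁻¹ + δ⁻¹ * (if r < δ⁻¹ then 1 else 0) + δ := by
  split_ifs with h
  · have h1 : 0 ≤ δ * (r⁻¹ - δ⁻¹) ^ 2 := by positivity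
    have h2 : δ * (r⁻¹ - δ⁻¹) ^ 2 = δ * (r ^ 2)⁻¹ - 2 * r⁻¹ + δ⁻¹ := by
      rw [← inv_pow]
      generalize r⁻¹ = s
      field_simp
      ring
    have h3 : 0 ≤ r⁻¹ := inv_nonneg.2 hr
    linarith
  · have h1 : r⁻¹ ≤ δ := inv_le_of_inv_le₀ hδ (not_lt.1 h)
    have h2 : 0 ≤ δ * (r ^ 2)⁻¹ := by positivity
    linarith

/-- Bound on the Coulomb potential of `f` by a Hardy-type integral, the mass near `x` and
the total mass. -/
lemma lintegral_div_norm_sub_le {E : Type*} [NormedAddCommGroup E] [MeasurableSpace E]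
    [OpensMeasurableSpace E] {μ : Measure E} {f : E → ℝ} (hf : Integrable f μ)
    (hpos : ∀ y, 0 ≤ f y) (x : E) {K δ : ℝ} (hK : 0 ≤ K) (hδ : 0 < δ)
    (hK' : ∫⁻ y, ENNReal.ofReal (f y / ‖x - y‖ ^ 2) ∂μ ≤ ENNReal.ofReal K) :
    ∫⁻ y, ENNReal.ofReal (f y / ‖x - y‖) ∂μ ≤
      ENNReal.ofReal (δ * K + δ⁻¹ * ∫ y in ball x δ⁻¹, f y ∂μ + δ * ∫ y, f y ∂μ) := by
  have hδ' : 0 < δ⁻¹ := inv_pos.2 hδ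
  have hm : AEMeasurable (fun y => ENNReal.ofReal (f y)) μ := hf.aemeasurable.ennreal_ofReal
  have hpt : ∀ y, ENNReal.ofReal (f y / ‖x - y‖) ≤
      ENNReal.ofReal δ * ENNReal.ofReal (f y / ‖x - y‖ ^ 2) +
        ENNReal.ofReal δ⁻¹ * (ball x δ⁻¹).indicator (fun y => ENNReal.ofReal (f y)) y +
        ENNReal.ofReal δ * ENNReal.ofReal (f y) := by
    intro y
    have hind : (ball x δ⁻¹).indicator (fun y => ENNReal.ofReal (f y)) y =
        ENNReal.ofReal (f y * if ‖x - y‖ < δ⁻¹ then 1 else 0) := by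
      have hball : y ∈ ball x δ⁻¹ ↔ ‖x - y‖ < δ⁻¹ := by rw [mem_ball', dist_eq_norm]
      by_cases h : ‖x - y‖ < δ⁻¹
      · rw [Set.indicator_of_mem (hball.2 h), if_pos h, mul_one]
      · rw [Set.indicator_of_notMem (mt hball.1 h), if_neg h, mul_zero, ENNReal.ofReal_zero]
    have hi : (0 : ℝ) ≤ if ‖x - y‖ < δ⁻¹ then 1 else 0 := by split_ifs <;> norm_num
    have hy := hpos y
    rw [hind, ← ENNReal.ofReal_mul hδ.le, ← ENNReal.ofReal_mul hδ'.le,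
      ← ENNReal.ofReal_mul hδ.le, ← ENNReal.ofReal_add (by positivity) (by positivity),
      ← ENNReal.ofReal_add (by positivity) (by positivity)]
    apply ENNReal.ofReal_le_ofReal
    calc f y / ‖x - y‖ = f y * ‖x - y‖⁻¹ := div_eq_mul_inv _ _
      _ ≤ f y * _ := mul_le_mul_of_nonneg_left
          (inv_le_mul_inv_sq_add_indicator hδ (norm_nonneg (x - y))) hy
      _ = _ := by rw [div_eq_mul_inv]; ring
  have hmass (s : Set E) : 0 ≤ ∫ y in s, f y ∂μ := integral_nonneg hpos
  have htot : 0 ≤ ∫ y, f y ∂μ := integral_nonneg hpos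
  have hb := hmass (ball x δ⁻¹)
  calc ∫⁻ y, ENNReal.ofReal (f y / ‖x - y‖) ∂μ ≤ _ := lintegral_mono hpt
    _ = ENNReal.ofReal δ * ∫⁻ y, ENNReal.ofReal (f y / ‖x - y‖ ^ 2) ∂μ +
        ENNReal.ofReal δ⁻¹ * ∫⁻ y in ball x δ⁻¹, ENNReal.ofReal (f y) ∂μ +
        ENNReal.ofReal δ * ∫⁻ y, ENNReal.ofReal (f y) ∂μ := by
      rw [lintegral_add_right' _ (hm.const_mul _),
        lintegral_add_right' _ ((hm.indicator measurableSet_ball).const_mul _),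
        lintegral_const_mul' _ _ ENNReal.ofReal_ne_top,
        lintegral_const_mul' _ _ ENNReal.ofReal_ne_top,
        lintegral_const_mul' _ _ ENNReal.ofReal_ne_top,
        lintegral_indicator measurableSet_ball]
    _ ≤ ENNReal.ofReal δ * ENNReal.ofReal K +
        ENNReal.ofReal δ⁻¹ * ENNReal.ofReal (∫ y in ball x δ⁻¹, f y ∂μ) +
        ENNReal.ofReal δ * ENNReal.ofReal (∫ y, f y ∂μ) := by
      rw [ofReal_integral_eq_lintegral_ofReal hf (.of_forall hpos),
        ofReal_integral_eq_lintegral_ofReal hf.integrableOn (.of_forall hpos)]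
      gcongr
    _ = _ := by
      rw [← ENNReal.ofReal_mul hδ.le, ← ENNReal.ofReal_mul hδ'.le,
        ← ENNReal.ofReal_mul hδ.le, ← ENNReal.ofReal_add (by positivity) (by positivity),
        ← ENNReal.ofReal_add (by positivity) (by positivity)]

/-- A uniform bound on the Coulomb potential bounds the Coulomb energy. -/
lemma coulombEnergy_le_of_potential_le {f : EuclideanSpace ℝ (Fin 3) → ℝ} (hf : Integrable f)
    (hpos : ∀ x, 0 ≤ f x) {b : ℝ}
    (hb : ∀ x, ∫⁻ y, ENNReal.ofReal (f y / ‖x - y‖) ≤ ENNReal.ofReal b) :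
    coulombEnergy f ≤ ENNReal.ofReal (1 / 2 * (∫ x, f x) * b) := by
  have hin (x : EuclideanSpace ℝ (Fin 3)) :
      ∫⁻ y, ENNReal.ofReal (f x * f y / ‖x - y‖) ≤ ENNReal.ofReal (f x) * ENNReal.ofReal b := by
    simp_rw [mul_div_assoc, ENNReal.ofReal_mul (hpos x)]
    rw [lintegral_const_mul' _ _ ENNReal.ofReal_ne_top]
    gcongr
    exact hb x
  have htot : 0 ≤ ∫ x, f x := integral_nonneg hpos
  have hhalf : ENNReal.ofReal (1 / 2) = 1 / 2 := by
    rw [ENNReal.ofReal_div_of_pos two_pos]; simp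
  rw [ENNReal.ofReal_mul (by positivity), ENNReal.ofReal_mul (by positivity),
    ofReal_integral_eq_lintegral_ofReal hf (.of_forall hpos), mul_assoc, hhalf, coulombEnergy,
    ← lintegral_mul_const' _ _ ENNReal.ofReal_ne_top]
  gcongr with x
  exact hin x

/-- **Vanishing kills the Coulomb energy.** If `(ρ_k)` is a sequence of nonnegative `L¹`
functions of constant mass `N`, with `sup_k sup_x ∫ ρ_k(y)/|x-y|² dy ≤ C²`, and `(ρ_k)` is
vanishing, then `D(ρ_k) → 0`. -/
theorem coulombEnergy_tendsto_zero_of_vanishing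
    (N C : ℝ) (hN : 0 < N) (hC : 0 ≤ C)
    (ρ : ℕ → EuclideanSpace ℝ (Fin 3) → ℝ)
    (hint : ∀ k, Integrable (ρ k))
    (hpos : ∀ k x, 0 ≤ ρ k x)
    (hmass : ∀ k, (∫ x, ρ k x) = N)
    (hhardy : ∀ k, ∀ x : EuclideanSpace ℝ (Fin 3),
      (∫⁻ y, ENNReal.ofReal (ρ k y / ‖x - y‖ ^ 2)) ≤ ENNReal.ofReal (C ^ 2))
    (hvan : ∀ R > (0:ℝ),
      Tendsto (fun k => ⨆ y : EuclideanSpace ℝ (Fin 3), ∫ x in ball y R, ρ k x)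
        atTop (nhds 0)) :
    Tendsto (fun k => coulombEnergy (ρ k)) atTop (nhds 0) := by
  rw [ENNReal.tendsto_nhds_zero]
  intro η hη
  obtain ⟨ε, hε, hεη⟩ := ENNReal.lt_iff_exists_nnreal_btwn.1 hη
  have hε : 0 < (ε : ℝ) := by exact_mod_cast hε
  set δ : ℝ := ε / (N * (C ^ 2 + N)) with hδ_def
  have hδ : 0 < δ := by positivity
  filter_upwards [(hvan δ⁻¹ (inv_pos.2 hδ)).eventually_le_const
    (show (0 : ℝ) < δ * (ε / N) by positivity)] with k hk
  have hbdd : BddAbove (Set.range fun y => ∫ x in ball y δ⁻¹, ρ k x) := by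
    refine ⟨N, ?_⟩
    rintro _ ⟨y, rfl⟩
    rw [← hmass k]
    exact setIntegral_le_integral (hint k) (.of_forall (hpos k))
  have hpot (x : EuclideanSpace ℝ (Fin 3)) :
      ∫⁻ y, ENNReal.ofReal (ρ k y / ‖x - y‖) ≤ ENNReal.ofReal (2 * (ε / N)) := by
    refine (lintegral_div_norm_sub_le (hint k) (hpos k) x (sq_nonneg C) hδ
      (hhardy k x)).trans (ENNReal.ofReal_le_ofReal ?_)
    have h1 : δ⁻¹ * ∫ y in ball x δ⁻¹, ρ k y ≤ ε / N :=
      (inv_mul_le_iff₀ hδ).2 ((le_ciSup hbdd x).trans hk)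
    have h2 : δ * (C ^ 2 + N) = ε / N := by
      rw [hδ_def]
      field_simp
    rw [hmass k]
    linarith
  refine (coulombEnergy_le_of_potential_le (hint k) (hpos k) hpot).trans
    (le_trans (le_of_eq ?_) hεη.le)
  rw [hmass k, show 1 / 2 * N * (2 * (ε / N)) = (ε : ℝ) by field_simp,
    ENNReal.ofReal_coe_nnreal]
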